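/- If u solves the cylindrical Helmholtz equation with parameter k, then the function X₅u : (r,θ,z) ↦ −cos θ · u_r(r,θ,z) + (sin θ / r) · u_θ(r,θ,z) also solves the cylindrical Helmholtz equation with parameter k on the region r > 0. (Infinitesimal invariance under the symmetry generator X₅ = −cos θ ∂_r + (sin θ / r) ∂_θ of Theorem 1.) -/

import Mathlib

/-- Partial derivative with respect to the first argument. -/
noncomputable def p1 (u : ℝ → ℝ → ℝ → ℝ) (r θ z : ℝ) : ℝ :=
  deriv (fun s => u s θ z) r

/-- Partial derivative with respect to the second argument. -/
noncomputable def p2 (u : ℝ → ℝ → ℝ → ℝ) (r θ z : ℝ) : ℝ :=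
  deriv (fun s => u r s z) θ

/-- Partial derivative with respect to the third argument. -/
noncomputable def p3 (u : ℝ → ℝ → ℝ → ℝ) (r θ z : ℝ) : ℝ :=
  deriv (fun s => u r θ s) z

/-- The cylindrical Helmholtz equation holds at the point `(r, θ, z)`:
`u_rr + (1/r)·u_r + (1/r²)·u_θθ + u_zz + k²·u = 0`. -/
def CHEat (k : ℝ) (u : ℝ → ℝ → ℝ → ℝ) (r θ z : ℝ) : Prop :=
  p1 (p1 u) r θ z + (1 / r) * p1 u r θ z + (1 / r ^ 2) * p2 (p2 u) r θ z
    + p3 (p3 u) r θ z + k ^ 2 * u r θ z = 0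

/-- `u` is a smooth function solving the cylindrical Helmholtz equation with
parameter `k` (at every point with `r > 0`). -/
def SolvesCHE (k : ℝ) (u : ℝ → ℝ → ℝ → ℝ) : Prop :=
  ContDiff ℝ (⊤ : ℕ∞) (fun p : ℝ × ℝ × ℝ => u p.1 p.2.1 p.2.2) ∧
    ∀ r θ z : ℝ, 0 < r → CHEat k u r θ z

/-- joint smoothness -/
def Sm (u : ℝ → ℝ → ℝ → ℝ) : Prop :=
  ContDiff ℝ (⊤ : ℕ∞) (fun p : ℝ × ℝ × ℝ => u p.1 p.2.1 p.2.2)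

section aux
variable {u : ℝ → ℝ → ℝ → ℝ}

theorem Sm.diff (h : Sm u) : Differentiable ℝ (fun p : ℝ × ℝ × ℝ => u p.1 p.2.1 p.2.2) :=
  ContDiff.differentiable h (by simp)

theorem Sm.e1 (h : Sm u) (r θ z : ℝ) : HasDerivAt (fun s => u s θ z)
    (fderiv ℝ (fun p : ℝ × ℝ × ℝ => u p.1 p.2.1 p.2.2) (r, θ, z) (1, 0, 0)) r := by
  have h1 : HasDerivAt (fun s : ℝ => (s, θ, z)) ((1 : ℝ), (0 : ℝ), (0 : ℝ)) r :=
    (hasDerivAt_id r).prodMk ((hasDerivAt_const r θ).prodMk (hasDerivAt_const r z))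
  exact ((h.diff (r, θ, z)).hasFDerivAt).comp_hasDerivAt r h1

theorem Sm.e2 (h : Sm u) (r θ z : ℝ) : HasDerivAt (fun s => u r s z)
    (fderiv ℝ (fun p : ℝ × ℝ × ℝ => u p.1 p.2.1 p.2.2) (r, θ, z) (0, 1, 0)) θ := by
  have h1 : HasDerivAt (fun s : ℝ => (r, s, z)) ((0 : ℝ), (1 : ℝ), (0 : ℝ)) θ :=
    (hasDerivAt_const θ r).prodMk ((hasDerivAt_id θ).prodMk (hasDerivAt_const θ z))
  exact ((h.diff (r, θ, z)).hasFDerivAt).comp_hasDerivAt θ h1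

theorem Sm.e3 (h : Sm u) (r θ z : ℝ) : HasDerivAt (fun s => u r θ s)
    (fderiv ℝ (fun p : ℝ × ℝ × ℝ => u p.1 p.2.1 p.2.2) (r, θ, z) (0, 0, 1)) z := by
  have h1 : HasDerivAt (fun s : ℝ => (r, θ, s)) ((0 : ℝ), (0 : ℝ), (1 : ℝ)) z :=
    (hasDerivAt_const z r).prodMk ((hasDerivAt_const z θ).prodMk (hasDerivAt_id z))
  exact ((h.diff (r, θ, z)).hasFDerivAt).comp_hasDerivAt z h1

theorem Sm.d1 (h : Sm u) (r θ z : ℝ) : HasDerivAt (fun s => u s θ z) (p1 u r θ z) r :=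
  (h.e1 r θ z).differentiableAt.hasDerivAt
theorem Sm.d2 (h : Sm u) (r θ z : ℝ) : HasDerivAt (fun s => u r s z) (p2 u r θ z) θ :=
  (h.e2 r θ z).differentiableAt.hasDerivAt
theorem Sm.d3 (h : Sm u) (r θ z : ℝ) : HasDerivAt (fun s => u r θ s) (p3 u r θ z) z :=
  (h.e3 r θ z).differentiableAt.hasDerivAt

theorem Sm.fd (h : Sm u) (v : ℝ × ℝ × ℝ) : ContDiff ℝ (⊤ : ℕ∞)
    (fun p => fderiv ℝ (fun p : ℝ × ℝ × ℝ => u p.1 p.2.1 p.2.2) p v) :=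
  (ContDiff.fderiv_right (m := (⊤ : ℕ∞)) h (by simp)).clm_apply contDiff_const

theorem Sm.q1 (h : Sm u) : (fun p : ℝ × ℝ × ℝ => p1 u p.1 p.2.1 p.2.2) =
    fun p => fderiv ℝ (fun p : ℝ × ℝ × ℝ => u p.1 p.2.1 p.2.2) p (1, 0, 0) :=
  funext fun p => (h.e1 p.1 p.2.1 p.2.2).deriv
theorem Sm.q2 (h : Sm u) : (fun p : ℝ × ℝ × ℝ => p2 u p.1 p.2.1 p.2.2) =
    fun p => fderiv ℝ (fun p : ℝ × ℝ × ℝ => u p.1 p.2.1 p.2.2) p (0, 1, 0) :=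
  funext fun p => (h.e2 p.1 p.2.1 p.2.2).deriv
theorem Sm.q3 (h : Sm u) : (fun p : ℝ × ℝ × ℝ => p3 u p.1 p.2.1 p.2.2) =
    fun p => fderiv ℝ (fun p : ℝ × ℝ × ℝ => u p.1 p.2.1 p.2.2) p (0, 0, 1) :=
  funext fun p => (h.e3 p.1 p.2.1 p.2.2).deriv

theorem Sm.s1 (h : Sm u) : Sm (p1 u) := by unfold Sm; rw [h.q1]; exact h.fd _
theorem Sm.s2 (h : Sm u) : Sm (p2 u) := by unfold Sm; rw [h.q2]; exact h.fd _
theorem Sm.s3 (h : Sm u) : Sm (p3 u) := by unfold Sm; rw [h.q3]; exact h.fd _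

theorem Sm.comm (h : Sm u) (p v w : ℝ × ℝ × ℝ) :
    fderiv ℝ (fun p => fderiv ℝ (fun p : ℝ × ℝ × ℝ => u p.1 p.2.1 p.2.2) p v) p w =
    fderiv ℝ (fun p => fderiv ℝ (fun p : ℝ × ℝ × ℝ => u p.1 p.2.1 p.2.2) p w) p v := by
  have hd : DifferentiableAt ℝ (fderiv ℝ (fun p : ℝ × ℝ × ℝ => u p.1 p.2.1 p.2.2)) p :=
    (ContDiff.fderiv_right (m := (⊤ : ℕ∞)) h (by simp)).differentiable (by simp) p
  have hs : IsSymmSndFDerivAt ℝ (fun p : ℝ × ℝ × ℝ => u p.1 p.2.1 p.2.2) p :=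
    (ContDiff.contDiffAt h).isSymmSndFDerivAt (by simpa using (WithTop.coe_le_coe.2 (le_top : (2 : ℕ∞) ≤ ⊤)))
  rw [fderiv_clm_apply hd (by fun_prop), fderiv_clm_apply hd (by fun_prop)]
  simpa using hs.eq w v

theorem Sm.c21 (h : Sm u) : p2 (p1 u) = p1 (p2 u) := by
  funext r θ z
  rw [p2, p1, (h.s1.e2 r θ z).deriv, (h.s2.e1 r θ z).deriv, h.q1, h.q2, h.comm]
theorem Sm.c31 (h : Sm u) : p3 (p1 u) = p1 (p3 u) := by
  funext r θ z
  rw [p3, p1, (h.s1.e3 r θ z).deriv, (h.s3.e1 r θ z).deriv, h.q1, h.q3, h.comm]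
theorem Sm.c32 (h : Sm u) : p3 (p2 u) = p2 (p3 u) := by
  funext r θ z
  rw [p3, p2, (h.s2.e3 r θ z).deriv, (h.s3.e2 r θ z).deriv, h.q2, h.q3, h.comm]
end aux

/-- Infinitesimal invariance under `X₅ = −cos θ ∂_r + (sin θ / r) ∂_θ`: if `u`
solves the cylindrical Helmholtz equation with parameter `k`, then so does
`X₅u = −cos θ · u_r + (sin θ / r) · u_θ` on the region `r > 0`. -/
theorem che_X5_infinitesimal_symmetry (k : ℝ) (u : ℝ → ℝ → ℝ → ℝ)
    (hu : SolvesCHE k u) :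
    ∀ r θ z : ℝ, 0 < r →
      CHEat k (fun r θ z =>
        -Real.cos θ * p1 u r θ z + (Real.sin θ / r) * p2 u r θ z) r θ z := by
  intro r θ z hr
  obtain ⟨h, hE⟩ := hu
  replace h : Sm u := h
  have hr0 : r ≠ 0 := hr.ne'
  have hI : ∀ s : ℝ, s ≠ 0 → HasDerivAt (fun s : ℝ => 1 / s) (-1 / s ^ 2) s := by
    intro s hs
    simpa [neg_div] using hasDerivAt_inv hs
  have hI2 : HasDerivAt (fun s : ℝ => 1 / s ^ 2) (-2 / r ^ 3) r := by
    have e : -2 / r ^ 3 = -(((2 : ℕ) : ℝ) * r ^ (2 - 1)) / (r ^ 2) ^ 2 := by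
      norm_num; field_simp
    rw [e]
    refine ((hasDerivAt_pow 2 r).inv (pow_ne_zero 2 hr0)).congr_of_eventuallyEq
      (Filter.Eventually.of_forall fun s => ?_)
    simp
  -- derivatives of the equation
  have E1 := ((((h.s1.s1.d1 r θ z).add ((hI r hr0).mul (h.s1.d1 r θ z))).add
    (hI2.mul (h.s2.s2.d1 r θ z))).add (h.s3.s3.d1 r θ z)).add ((h.d1 r θ z).const_mul (k ^ 2))
  have E1' := E1.unique ((hasDerivAt_const r (0 : ℝ)).congr_of_eventuallyEq
    ((eventually_gt_nhds hr).mono fun s hs => hE s θ z hs))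
  have E2 := ((((h.s1.s1.d2 r θ z).add ((h.s1.d2 r θ z).const_mul (1 / r))).add
    ((h.s2.s2.d2 r θ z).const_mul (1 / r ^ 2))).add (h.s3.s3.d2 r θ z)).add
    ((h.d2 r θ z).const_mul (k ^ 2))
  have E2' := E2.unique ((hasDerivAt_const θ (0 : ℝ)).congr_of_eventuallyEq
    (Filter.Eventually.of_forall fun s => hE r s z hr))
  -- derivatives of the new function
  set v : ℝ → ℝ → ℝ → ℝ := fun r θ z =>
        -Real.cos θ * p1 u r θ z + (Real.sin θ / r) * p2 u r θ z with hv
  have hA : ∀ s : ℝ, s ≠ 0 → p1 v s θ z = -Real.cos θ * p1 (p1 u) s θ z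
      + Real.sin θ * (-1 / s ^ 2 * p2 u s θ z + 1 / s * p1 (p2 u) s θ z) := by
    intro s hs
    have := ((h.s1.d1 s θ z).const_mul (-Real.cos θ)).add
      (((hI s hs).mul (h.s2.d1 s θ z)).const_mul (Real.sin θ))
    refine HasDerivAt.deriv (this.congr_of_eventuallyEq (Filter.Eventually.of_forall fun t => ?_))
    simp [hv]; ring
  have hN : HasDerivAt (fun s : ℝ => -1 / s ^ 2) (2 / r ^ 3) r := by
    have e : 2 / r ^ 3 = -(-2 / r ^ 3) := by ring
    rw [e]
    refine hI2.neg.congr_of_eventuallyEq (Filter.Eventually.of_forall fun s => ?_)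
    simp [neg_div]
  have hAA : p1 (p1 v) r θ z = -Real.cos θ * p1 (p1 (p1 u)) r θ z
      + Real.sin θ * ((2 / r ^ 3 * p2 u r θ z + -1 / r ^ 2 * p1 (p2 u) r θ z)
        + (-1 / r ^ 2 * p1 (p2 u) r θ z + 1 / r * p1 (p1 (p2 u)) r θ z)) := by
    have := ((h.s1.s1.d1 r θ z).const_mul (-Real.cos θ)).add
      (((hN.mul (h.s2.d1 r θ z)).add
      ((hI r hr0).mul (h.s2.s1.d1 r θ z))).const_mul (Real.sin θ))
    exact HasDerivAt.deriv (this.congr_of_eventuallyEq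
      ((eventually_gt_nhds hr).mono fun s hs => hA s (ne_of_gt hs)))
  have hB : ∀ t : ℝ, p2 v r t z = (Real.sin t * p1 u r t z + -Real.cos t * p2 (p1 u) r t z)
      + 1 / r * (Real.cos t * p2 u r t z + Real.sin t * p2 (p2 u) r t z) := by
    intro t
    have := ((Real.hasDerivAt_cos t).neg.mul (h.s1.d2 r t z)).add
      (((Real.hasDerivAt_sin t).mul (h.s2.d2 r t z)).const_mul (1 / r))
    rw [neg_neg] at this
    refine HasDerivAt.deriv (this.congr_of_eventuallyEq (Filter.Eventually.of_forall fun t => ?_))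
    simp [hv]; ring
  have hBB : p2 (p2 v) r θ z = ((Real.cos θ * p1 u r θ z + Real.sin θ * p2 (p1 u) r θ z)
      + (Real.sin θ * p2 (p1 u) r θ z + -Real.cos θ * p2 (p2 (p1 u)) r θ z))
      + 1 / r * ((-Real.sin θ * p2 u r θ z + Real.cos θ * p2 (p2 u) r θ z)
       + (Real.cos θ * p2 (p2 u) r θ z + Real.sin θ * p2 (p2 (p2 u)) r θ z)) := by
    have := (((Real.hasDerivAt_sin θ).mul (h.s1.d2 r θ z)).add
      ((Real.hasDerivAt_cos θ).neg.mul (h.s1.s2.d2 r θ z))).add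
      ((((Real.hasDerivAt_cos θ).mul (h.s2.d2 r θ z)).add
      ((Real.hasDerivAt_sin θ).mul (h.s2.s2.d2 r θ z))).const_mul (1 / r))
    rw [neg_neg] at this
    exact HasDerivAt.deriv (this.congr_of_eventuallyEq (Filter.Eventually.of_forall hB))
  have hC : ∀ t : ℝ, p3 v r θ t = -Real.cos θ * p3 (p1 u) r θ t
      + (Real.sin θ / r) * p3 (p2 u) r θ t := fun t =>
    (((h.s1.d3 r θ t).const_mul (-Real.cos θ)).add
      ((h.s2.d3 r θ t).const_mul (Real.sin θ / r))).deriv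
  have hCC : p3 (p3 v) r θ z = -Real.cos θ * p3 (p3 (p1 u)) r θ z
      + (Real.sin θ / r) * p3 (p3 (p2 u)) r θ z :=
    HasDerivAt.deriv ((((h.s1.s3.d3 r θ z).const_mul (-Real.cos θ)).add
      ((h.s2.s3.d3 r θ z).const_mul (Real.sin θ / r))).congr_of_eventuallyEq
      (Filter.Eventually.of_forall hC))
  have hv0 : v r θ z = -Real.cos θ * p1 u r θ z + (Real.sin θ / r) * p2 u r θ z := rfl
  unfold CHEat
  rw [hAA, hA r hr0, hBB, hCC, hv0]
  rw [h.s1.c21, h.c21] at E2'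
  rw [h.c21, h.s2.c21, h.c31, h.s3.c31, h.c32, h.s3.c32]
  linear_combination (exp := 1) (-Real.cos θ) * E1' + (Real.sin θ / r) * E2'
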